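/- arXiv:1412.0815 — 2 statements merged into one kernel-verified Lean document; each statement's English description precedes it below -/
import Mathlib

section
/- Let (b,c) be a connected graph over a countably infinite set X. Then the following are equivalent: (i) D₀ ⊆ C₀(X) (uniform transience); (ii) for every measure m of full support on X, the closure of C_c(X) with respect to the norm ‖·‖_Q = (Q(·) + ‖·‖_m²)^{1/2} is contained in C₀(X); (iii) the inclusion in (ii) holds for every measure m of full support with total mass m(X) = Σ_{x∈X} m(x) < ∞. -/
open ENNReal Filter Topology

namespace UTGraph

variable {X : Type*}

/-- A graph over `X`: symmetric nonnegative edge weight `b` with zero diagonal and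
summable rows, together with a nonnegative potential (killing term) `c`. -/
structure IsGraph (b : X → X → ℝ) (c : X → ℝ) : Prop where
  symm : ∀ x y, b x y = b y x
  nonneg : ∀ x y, 0 ≤ b x y
  loopless : ∀ x, b x x = 0
  row_summable : ∀ x, Summable fun y => b x y
  c_nonneg : ∀ x, 0 ≤ c x

/-- Connectedness: any two vertices are joined by a path of positive edge weights. -/
def Connected (b : X → X → ℝ) : Prop :=
  ∀ x y : X, Relation.ReflTransGen (fun u v => 0 < b u v) x y

/-- The energy form `Q(f)`, with values in `[0,∞]`. -/
noncomputable def energy (b : X → X → ℝ) (c : X → ℝ) (f : X → ℝ) : ℝ≥0∞ :=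
  (1 / 2) * ∑' p : X × X, ENNReal.ofReal (b p.1 p.2 * (f p.1 - f p.2) ^ 2)
    + ∑' x, ENNReal.ofReal (c x * f x ^ 2)

/-- `f` has finite energy, i.e. `f ∈ D`. -/
def FiniteEnergy (b : X → X → ℝ) (c : X → ℝ) (f : X → ℝ) : Prop :=
  energy b c f < ⊤

/-- The bilinear energy form `Q(f,g)` (for finite-energy functions). -/
noncomputable def energyBilin (b : X → X → ℝ) (c : X → ℝ) (f g : X → ℝ) : ℝ :=
  (1 / 2) * ∑' p : X × X, b p.1 p.2 * (f p.1 - f p.2) * (g p.1 - g p.2)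
    + ∑' x, c x * f x * g x

/-- `f ∈ C_c(X)`: finitely supported function. -/
def FinSupp (f : X → ℝ) : Prop := (Function.support f).Finite

/-- The norm `‖f‖_o = (Q(f) + f(o)²)^{1/2}`. -/
noncomputable def normO (b : X → X → ℝ) (c : X → ℝ) (o : X) (f : X → ℝ) : ℝ :=
  Real.sqrt ((energy b c f).toReal + f o ^ 2)

/-- `f ∈ D₀`: there is a sequence of finitely supported functions converging to `f`
pointwise whose energy difference to `f` tends to `0`. -/
def MemD0 (b : X → X → ℝ) (c : X → ℝ) (f : X → ℝ) : Prop :=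
  ∃ φ : ℕ → X → ℝ, (∀ n, FinSupp (φ n)) ∧
    (∀ x, Tendsto (fun n => φ n x) atTop (𝓝 (f x))) ∧
    Tendsto (fun n => energy b c (φ n - f)) atTop (𝓝 0)

/-- `f ∈ C₀(X)`: `f` belongs to the uniform closure of the finitely supported functions,
i.e. for every `ε > 0` the set where `|f| ≥ ε` is finite. -/
def MemC0 (f : X → ℝ) : Prop := ∀ ε : ℝ, 0 < ε → {x | ε ≤ |f x|}.Finite

/-- The graph is uniformly transient: `D₀ ⊆ C₀(X)`. -/
def UniformlyTransient (b : X → X → ℝ) (c : X → ℝ) : Prop :=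
  ∀ f : X → ℝ, MemD0 b c f → MemC0 f

/-- The capacity of a point: `cap(x) = inf {Q(φ) : φ ∈ C_c(X), φ(x) = 1}`. -/
noncomputable def cap (b : X → X → ℝ) (c : X → ℝ) (x : X) : ℝ≥0∞ :=
  ⨅ (φ : X → ℝ) (_ : FinSupp φ) (_ : φ x = 1), energy b c φ

/-- `f ∈ F`: the domain of the formal Laplacian. -/
def MemF (b : X → X → ℝ) (f : X → ℝ) : Prop :=
  ∀ x, Summable fun y => b x y * |f y|

/-- The formal Laplacian `𝓛 f (x) = Σ_y b(x,y)(f(x) - f(y)) + c(x) f(x)`. -/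
noncomputable def formalLaplacian (b : X → X → ℝ) (c : X → ℝ) (f : X → ℝ) (x : X) : ℝ :=
  (∑' y, b x y * (f x - f y)) + c x * f x

/-- `f` is harmonic: `f ∈ F` and `𝓛 f = 0`. -/
def Harmonic (b : X → X → ℝ) (c : X → ℝ) (f : X → ℝ) : Prop :=
  MemF b f ∧ ∀ x, formalLaplacian b c f x = 0

/-- The graph is recurrent: the constant function `1` lies in `D₀` and `Q(1) = 0`. -/
def Recurrent (b : X → X → ℝ) (c : X → ℝ) : Prop :=
  MemD0 b c 1 ∧ energy b c 1 = 0

/-- The graph is transient: not recurrent. -/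
def Transient (b : X → X → ℝ) (c : X → ℝ) : Prop := ¬ Recurrent b c

/-- The metric `γ_o`. -/
noncomputable def gammaO (b : X → X → ℝ) (c : X → ℝ) (o x y : X) : ℝ :=
  sSup {d : ℝ | ∃ φ : X → ℝ, FinSupp φ ∧
    energy b c φ + ENNReal.ofReal (φ o ^ 2) ≤ 1 ∧ d = |φ x - φ y|}

/-- The metric `γ`. -/
noncomputable def gamma (b : X → X → ℝ) (c : X → ℝ) (x y : X) : ℝ :=
  sSup {d : ℝ | ∃ φ : X → ℝ, FinSupp φ ∧ energy b c φ ≤ 1 ∧ d = |φ x - φ y|}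

/-- `d` is a metric on `X`. -/
def IsMetric (d : X → X → ℝ) : Prop :=
  (∀ x y, 0 ≤ d x y) ∧ (∀ x y, d x y = d y x) ∧
  (∀ x y, d x y = 0 ↔ x = y) ∧ (∀ x y z, d x z ≤ d x y + d y z)

/-- `f` belongs to the closure of `C_c(X)` with respect to the norm
`‖·‖_Q = (Q(·) + ‖·‖_m²)^{1/2}` inside `D ∩ ℓ²(X,m)`. -/
def MemFormDomain (b : X → X → ℝ) (c : X → ℝ) (m : X → ℝ) (f : X → ℝ) : Prop :=
  FiniteEnergy b c f ∧ Summable (fun x => m x * f x ^ 2) ∧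
  ∃ φ : ℕ → X → ℝ, (∀ n, FinSupp (φ n)) ∧
    Tendsto (fun n => energy b c (f - φ n)
      + ∑' x, ENNReal.ofReal (m x * (f x - φ n x) ^ 2)) atTop (𝓝 0)

end UTGraph

namespace UTGraph

variable {X : Type*} {b : X → X → ℝ} {c : X → ℝ}

/-- The energy form is even. -/
theorem energy_sub_comm (f g : X → ℝ) : energy b c (f - g) = energy b c (g - f) := by
  unfold energy
  congr 2
  · congr 1
    funext p
    simp only [Pi.sub_apply]
    congr 1
    ring
  · funext x
    simp only [Pi.sub_apply]
    congr 1
    ring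

/-- The square of a sum is at most twice the sum of the squares, in a weighted `[0,∞]` form. -/
theorem ofReal_mul_sq_add_le {w : ℝ} (hw : 0 ≤ w) (s t : ℝ) :
    ENNReal.ofReal (w * (s + t) ^ 2) ≤
      2 * ENNReal.ofReal (w * s ^ 2) + 2 * ENNReal.ofReal (w * t ^ 2) := by
  rw [← ENNReal.ofReal_ofNat 2, ← ENNReal.ofReal_mul (by norm_num),
    ← ENNReal.ofReal_mul (by norm_num), ← ENNReal.ofReal_add (by positivity) (by positivity)]
  apply ENNReal.ofReal_le_ofReal
  nlinarith [mul_nonneg hw (sq_nonneg (s - t))]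

theorem IsGraph.energy_add_le (h : IsGraph b c) (f g : X → ℝ) :
    energy b c (f + g) ≤ 2 * energy b c f + 2 * energy b c g := by
  unfold energy
  calc (1 / 2) * ∑' p : X × X, ENNReal.ofReal (b p.1 p.2 * ((f + g) p.1 - (f + g) p.2) ^ 2)
        + ∑' x, ENNReal.ofReal (c x * (f + g) x ^ 2)
      ≤ (1 / 2) * ∑' p : X × X, (2 * ENNReal.ofReal (b p.1 p.2 * (f p.1 - f p.2) ^ 2)
            + 2 * ENNReal.ofReal (b p.1 p.2 * (g p.1 - g p.2) ^ 2))
        + ∑' x, (2 * ENNReal.ofReal (c x * f x ^ 2) + 2 * ENNReal.ofReal (c x * g x ^ 2)) := by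
        gcongr with p x
        · rw [Pi.add_apply, Pi.add_apply, add_sub_add_comm]
          exact ofReal_mul_sq_add_le (h.nonneg _ _) _ _
        · exact ofReal_mul_sq_add_le (h.c_nonneg _) _ _
    _ = _ := by
        simp only [ENNReal.tsum_add, ENNReal.tsum_mul_left]
        ring

/-- Finitely supported functions have finite energy. -/
theorem IsGraph.finiteEnergy_of_finSupp (h : IsGraph b c) {φ : X → ℝ} (hφ : FinSupp φ) :
    FiniteEnergy b c φ := by
  have finite_sum : ∀ u : X → ℝ≥0∞, (∀ x, u x ≠ ⊤) → (∀ x, φ x = 0 → u x = 0) →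
      ∑' x, u x ≠ ⊤ := fun u hu hu0 => by
    rw [tsum_eq_sum (s := hφ.toFinset) fun x hx => hu0 x (by simpa using mt hφ.mem_toFinset.2 hx)]
    exact ENNReal.sum_ne_top.2 fun x _ => hu x
  have row : ∑' x, ∑' y, ENNReal.ofReal (b x y * φ x ^ 2) ≠ ⊤ := by
    refine finite_sum _ (fun x => ?_) fun x hx => by simp [hx]
    exact ((h.row_summable x).mul_right _).tsum_ofReal_ne_top
  have edges : ∑' p : X × X, ENNReal.ofReal (b p.1 p.2 * (φ p.1 - φ p.2) ^ 2) ≠ ⊤ := by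
    have bound : ∑' p : X × X, ENNReal.ofReal (b p.1 p.2 * (φ p.1 - φ p.2) ^ 2) ≤
        2 * ∑' x, ∑' y, ENNReal.ofReal (b x y * φ x ^ 2)
          + 2 * ∑' x, ∑' y, ENNReal.ofReal (b x y * φ x ^ 2) := by
      calc ∑' p : X × X, ENNReal.ofReal (b p.1 p.2 * (φ p.1 - φ p.2) ^ 2)
          ≤ ∑' p : X × X, (2 * ENNReal.ofReal (b p.1 p.2 * φ p.1 ^ 2)
              + 2 * ENNReal.ofReal (b p.2 p.1 * φ p.2 ^ 2)) := by
            gcongr with p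
            have key := ofReal_mul_sq_add_le (h.nonneg p.1 p.2) (φ p.1) (-φ p.2)
            rw [neg_sq, ← sub_eq_add_neg] at key
            rwa [h.symm p.2 p.1]
        _ = _ := by
            rw [ENNReal.tsum_add, ENNReal.tsum_mul_left, ENNReal.tsum_mul_left]
            congr 2
            · exact ENNReal.tsum_prod (f := fun x y => ENNReal.ofReal (b x y * φ x ^ 2))
            · rw [ENNReal.tsum_prod (f := fun x y => ENNReal.ofReal (b y x * φ y ^ 2)),
                ENNReal.tsum_comm]
    exact ne_top_of_le_ne_top (by finiteness) bound
  have killing : ∑' x, ENNReal.ofReal (c x * φ x ^ 2) ≠ ⊤ :=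
    finite_sum _ (fun x => ENNReal.ofReal_ne_top) fun x hx => by simp [hx]
  exact lt_top_iff_ne_top.2 (ENNReal.add_ne_top.2 ⟨ENNReal.mul_ne_top (by simp) edges, killing⟩)

/-- Every function in `D₀` has finite energy. -/
theorem MemD0.finiteEnergy (h : IsGraph b c) {f : X → ℝ} (hf : MemD0 b c f) :
    FiniteEnergy b c f := by
  obtain ⟨φ, hφ, -, hlim⟩ := hf
  obtain ⟨n, hn⟩ := (hlim.eventually (gt_mem_nhds ENNReal.zero_lt_top)).exists
  have key := h.energy_add_le (f - φ n) (φ n)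
  rw [sub_add_cancel, energy_sub_comm] at key
  exact key.trans_lt <| ENNReal.add_lt_top.2
    ⟨ENNReal.mul_lt_top (by simp) hn,
      ENNReal.mul_lt_top (by simp) (h.finiteEnergy_of_finSupp (hφ n))⟩

/-- The form domain of any measure of full support is contained in `D₀`. -/
theorem MemFormDomain.memD0 {m : X → ℝ} (hm : ∀ x, 0 < m x) {f : X → ℝ}
    (hf : MemFormDomain b c m f) : MemD0 b c f := by
  obtain ⟨-, -, φ, hφ, hlim⟩ := hf
  refine ⟨φ, hφ, fun x => ?_, ?_⟩
  · have weighted : Tendsto (fun n => ENNReal.ofReal (m x * (f x - φ n x) ^ 2)) atTop (𝓝 0) :=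
      tendsto_of_tendsto_of_tendsto_of_le_of_le tendsto_const_nhds hlim (fun _ => zero_le)
        fun n => (ENNReal.le_tsum x).trans le_add_self
    have real := (ENNReal.tendsto_toReal ENNReal.zero_ne_top).comp weighted
    have sq : Tendsto (fun n => (f x - φ n x) ^ 2) atTop (𝓝 0) := by
      have scaled := real.const_mul (m x)⁻¹
      rw [ENNReal.toReal_zero, mul_zero] at scaled
      refine scaled.congr fun n => ?_
      rw [Function.comp_apply,
        ENNReal.toReal_ofReal (mul_nonneg (hm x).le (sq_nonneg _)),
        inv_mul_cancel_left₀ (hm x).ne']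
    have abs_lim : Tendsto (fun n => |f x - φ n x|) atTop (𝓝 0) := by
      simpa [Function.comp_def, Real.sqrt_sq_eq_abs] using
        (Real.continuous_sqrt.tendsto 0).comp sq
    simpa using ((tendsto_zero_iff_abs_tendsto_zero _).2 abs_lim).const_sub (f x)
  · refine tendsto_of_tendsto_of_tendsto_of_le_of_le tendsto_const_nhds hlim
      (fun _ => zero_le) fun n => ?_
    change energy b c (φ n - f) ≤ _
    rw [energy_sub_comm]
    exact le_self_add

/-- Every function in `D₀` lies in the form domain of some finite measure of full support. -/
theorem MemD0.exists_memFormDomain [Countable X] (h : IsGraph b c) {f : X → ℝ}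
    (hf : MemD0 b c f) :
    ∃ m : X → ℝ, (∀ x, 0 < m x) ∧ Summable m ∧ MemFormDomain b c m f := by
  have hfin := hf.finiteEnergy h
  obtain ⟨φ, hφ, hpt, hlim⟩ := hf
  have hsq : ∀ x, Tendsto (fun n => (f x - φ n x) ^ 2) atTop (𝓝 0) := fun x => by
    simpa using ((hpt x).const_sub (f x)).pow 2
  choose M hM using fun x => (hsq x).bddAbove_range
  have hM' : ∀ x n, (f x - φ n x) ^ 2 ≤ M x := fun x n => hM x ⟨n, rfl⟩
  have hM0 : ∀ x, 0 ≤ M x := fun x => (sq_nonneg _).trans (hM' x 0)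
  obtain ⟨w, hw, _, hsum, -⟩ := NNReal.exists_pos_sum_of_countable one_ne_zero X
  have hws : Summable fun x => (w x : ℝ) := NNReal.summable_coe.2 hsum.summable
  have hw' : ∀ x, (0 : ℝ) < w x := fun x => NNReal.coe_pos.2 (hw x)
  have hden : ∀ x, 0 < 1 + M x + f x ^ 2 := fun x => by
    nlinarith [hM0 x, sq_nonneg (f x)]
  set m : X → ℝ := fun x => w x / (1 + M x + f x ^ 2) with hm_def
  have hm : ∀ x, 0 < m x := fun x => div_pos (hw' x) (hden x)
  have hmul : ∀ x t, t ≤ 1 + M x + f x ^ 2 → m x * t ≤ w x := fun x t ht => by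
    rw [hm_def, div_mul_eq_mul_div, div_le_iff₀ (hden x)]
    exact mul_le_mul_of_nonneg_left ht (hw' x).le
  have hdom : ∀ n x, m x * (f x - φ n x) ^ 2 ≤ w x := fun n x =>
    hmul x _ (by nlinarith [hM' x n, sq_nonneg (f x)])
  have hnn : ∀ n x, 0 ≤ m x * (f x - φ n x) ^ 2 := fun n x =>
    mul_nonneg (hm x).le (sq_nonneg _)
  refine ⟨m, hm, ?_, hfin, ?_, φ, hφ, ?_⟩
  · refine hws.of_nonneg_of_le (fun x => (hm x).le) fun x => ?_
    simpa using hmul x 1 (by nlinarith [hM0 x, sq_nonneg (f x)])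
  · exact hws.of_nonneg_of_le (fun x => mul_nonneg (hm x).le (sq_nonneg _)) fun x =>
      hmul x _ (by linarith [hM0 x])
  · have hreal : Tendsto (fun n => ∑' x, m x * (f x - φ n x) ^ 2) atTop (𝓝 0) := by
      have := tendsto_tsum_of_dominated_convergence (𝓕 := atTop)
        (f := fun n x => m x * (f x - φ n x) ^ 2) (g := fun _ => 0) hws
        (fun x => by simpa using (hsq x).const_mul (m x))
        (Eventually.of_forall fun n x => by
          rw [Real.norm_of_nonneg (hnn n x)]
          exact hdom n x)
      simpa using this
    have hmass : Tendsto (fun n => ∑' x, ENNReal.ofReal (m x * (f x - φ n x) ^ 2)) atTop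
        (𝓝 0) := by
      rw [← ENNReal.ofReal_zero]
      exact (ENNReal.tendsto_ofReal hreal).congr fun n =>
        ENNReal.ofReal_tsum_of_nonneg (hnn n) (hws.of_nonneg_of_le (hnn n) (hdom n))
    simpa only [add_zero] using
      (hlim.congr fun n => energy_sub_comm _ _).add hmass

end UTGraph

open UTGraph Filter Topology ENNReal in
/-- uniform transience is equivalent to the uniform strong Feller
property: the form domain (the `‖·‖_Q`-closure of `C_c(X)`) is contained in `C₀(X)`
for all measures of full support, equivalently for all finite measures of full
support. -/
theorem stmt6 {X : Type*} [Countable X] [Infinite X]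
    (b : X → X → ℝ) (c : X → ℝ) (hgraph : IsGraph b c) (hconn : Connected b) :
    (UniformlyTransient b c ↔
      (∀ m : X → ℝ, (∀ x, 0 < m x) →
        ∀ f : X → ℝ, MemFormDomain b c m f → MemC0 f)) ∧
    ((∀ m : X → ℝ, (∀ x, 0 < m x) →
        ∀ f : X → ℝ, MemFormDomain b c m f → MemC0 f) ↔
      (∀ m : X → ℝ, (∀ x, 0 < m x) → Summable m →
        ∀ f : X → ℝ, MemFormDomain b c m f → MemC0 f)) := by
  have memC0_of_finite : (∀ m : X → ℝ, (∀ x, 0 < m x) → Summable m →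
      ∀ f : X → ℝ, MemFormDomain b c m f → MemC0 f) → UniformlyTransient b c :=
    fun H f hf => by
      obtain ⟨m, hm, hs, hmf⟩ := hf.exists_memFormDomain hgraph
      exact H m hm hs f hmf
  have memC0_of_transient : UniformlyTransient b c → ∀ m : X → ℝ, (∀ x, 0 < m x) →
      ∀ f : X → ℝ, MemFormDomain b c m f → MemC0 f :=
    fun H m hm f hf => H f (hf.memD0 hm)
  exact ⟨⟨memC0_of_transient, fun H => memC0_of_finite fun m hm _ => H m hm⟩,
    fun H m hm _ => H m hm, fun H => memC0_of_transient (memC0_of_finite H)⟩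
end

section
/- Let (b,c) be a connected graph over a countably infinite set X and let m be a measure of full support on X with δ := inf_{x∈X} m(x) > 0. If there exists λ > 0 such that λ · Σ_{x∈X} m(x)φ(x)² ≤ Q(φ) for all φ ∈ C_c(X) (i.e. the Dirichlet Laplacian has a spectral gap), then (b,c) is uniformly transient, i.e. D₀ ⊆ C₀(X). -/
open ENNReal Filter Topology

namespace UTGraph

theorem ofReal_mul_sub_sq_le {w : ℝ} (hw : 0 ≤ w) (s t : ℝ) :
    ENNReal.ofReal (w * (s - t) ^ 2) ≤
      2 * (ENNReal.ofReal (w * s ^ 2) + ENNReal.ofReal (w * t ^ 2)) := by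
  rw [← ENNReal.ofReal_add (by positivity) (by positivity), ← ENNReal.ofReal_ofNat 2,
    ← ENNReal.ofReal_mul (by norm_num)]
  refine ENNReal.ofReal_le_ofReal ?_
  nlinarith [mul_nonneg hw (sq_nonneg (s + t))]

theorem energy_sub_le {X : Type*} {b : X → X → ℝ} {c : X → ℝ} (hgraph : IsGraph b c)
    (f g : X → ℝ) : energy b c (f - g) ≤ 2 * (energy b c f + energy b c g) := by
  have hb : ∑' p : X × X, ENNReal.ofReal (b p.1 p.2 * ((f - g) p.1 - (f - g) p.2) ^ 2) ≤
      2 * (∑' p : X × X, ENNReal.ofReal (b p.1 p.2 * (f p.1 - f p.2) ^ 2) +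
        ∑' p : X × X, ENNReal.ofReal (b p.1 p.2 * (g p.1 - g p.2) ^ 2)) := by
    rw [← ENNReal.tsum_add, ← ENNReal.tsum_mul_left]
    refine ENNReal.tsum_le_tsum fun p => ?_
    have hp : (f - g) p.1 - (f - g) p.2 = (f p.1 - f p.2) - (g p.1 - g p.2) := by
      simp only [Pi.sub_apply]; ring
    rw [hp]
    exact ofReal_mul_sub_sq_le (hgraph.nonneg _ _) _ _
  have hc : ∑' x, ENNReal.ofReal (c x * (f - g) x ^ 2) ≤
      2 * (∑' x, ENNReal.ofReal (c x * f x ^ 2) + ∑' x, ENNReal.ofReal (c x * g x ^ 2)) := by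
    rw [← ENNReal.tsum_add, ← ENNReal.tsum_mul_left]
    exact ENNReal.tsum_le_tsum fun x => ofReal_mul_sub_sq_le (hgraph.c_nonneg _) _ _
  unfold energy
  refine (add_le_add (mul_le_mul_right hb (1 / 2)) hc).trans_eq ?_
  ring

theorem FinSupp.sub {X : Type*} {f g : X → ℝ} (hf : FinSupp f) (hg : FinSupp g) :
    FinSupp (f - g) :=
  (hf.union hg).subset (Function.support_sub f g)

/-- A spectral gap controls point values of finitely supported functions by their energy. -/
theorem mul_sq_apply_le_energy {X : Type*} {b : X → X → ℝ} {c m : X → ℝ} {δ lam : ℝ}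
    (hδ : 0 < δ) (hδm : ∀ x, δ ≤ m x) (hlam : 0 < lam)
    (hgap : ∀ φ : X → ℝ, FinSupp φ → lam * (∑' x, m x * φ x ^ 2) ≤ (energy b c φ).toReal)
    {φ : X → ℝ} (hφ : FinSupp φ) (x : X) :
    lam * δ * φ x ^ 2 ≤ (energy b c φ).toReal := by
  have hsum : Summable fun y => m y * φ y ^ 2 :=
    summable_of_hasFiniteSupport <| hφ.subset fun y hy h => hy (by simp [h])
  have hx : m x * φ x ^ 2 ≤ ∑' y, m y * φ y ^ 2 :=
    hsum.le_tsum x fun y _ => mul_nonneg (hδ.le.trans (hδm y)) (sq_nonneg _)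
  calc lam * δ * φ x ^ 2 = lam * (δ * φ x ^ 2) := mul_assoc _ _ _
    _ ≤ lam * ∑' y, m y * φ y ^ 2 := by
      gcongr
      exact (mul_le_mul_of_nonneg_right (hδm x) (sq_nonneg _)).trans hx
    _ ≤ _ := hgap φ hφ

end UTGraph

open UTGraph Filter Topology ENNReal in
/-- if `m` is a measure of full support bounded below by `δ > 0` and
the Dirichlet Laplacian has a spectral gap `λ > 0`, i.e.
`λ Σ m(x)φ(x)² ≤ Q(φ)` for all finitely supported `φ`, then the graph is
uniformly transient. -/
theorem stmt9 {X : Type*} [Countable X] [Infinite X]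
    (b : X → X → ℝ) (c : X → ℝ) (hgraph : IsGraph b c) (hconn : Connected b)
    (m : X → ℝ) (hm : ∀ x, 0 < m x) (δ : ℝ) (hδ : 0 < δ) (hδm : ∀ x, δ ≤ m x)
    (lam : ℝ) (hlam : 0 < lam)
    (hgap : ∀ φ : X → ℝ, FinSupp φ →
      lam * (∑' x, m x * φ x ^ 2) ≤ (energy b c φ).toReal) :
    UniformlyTransient b c := by
  rintro f ⟨φ, hφ, hlim, hen⟩ ε hε
  have hη : 0 < lam * δ * ε ^ 2 / 16 := by positivity
  obtain ⟨n, hn⟩ := eventually_atTop.1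
    (hen.eventually (gt_mem_nhds (ENNReal.ofReal_pos.2 hη)))
  have hdiff : ∀ k ≥ n, ∀ x, lam * δ * (φ n x - φ k x) ^ 2 ≤ lam * δ * (ε ^ 2 / 4) := by
    intro k hk x
    have hle : energy b c (φ n - φ k) ≤ ENNReal.ofReal (lam * δ * (ε ^ 2 / 4)) := by
      calc energy b c (φ n - φ k) = energy b c ((φ n - f) - (φ k - f)) := by
            rw [sub_sub_sub_cancel_right]
        _ ≤ 2 * (energy b c (φ n - f) + energy b c (φ k - f)) := energy_sub_le hgraph _ _
        _ ≤ 2 * (ENNReal.ofReal (lam * δ * ε ^ 2 / 16) +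
              ENNReal.ofReal (lam * δ * ε ^ 2 / 16)) := by
            gcongr
            exacts [(hn n le_rfl).le, (hn k hk).le]
        _ = ENNReal.ofReal (lam * δ * (ε ^ 2 / 4)) := by
            rw [← ENNReal.ofReal_add hη.le hη.le, ← ENNReal.ofReal_ofNat 2,
              ← ENNReal.ofReal_mul (by norm_num)]
            congr 1
            ring
    exact (mul_sq_apply_le_energy hδ hδm hlam hgap ((hφ n).sub (hφ k)) x).trans
      (ENNReal.toReal_le_of_le_ofReal (by positivity) hle)
  refine (hφ n).subset fun x hx h0 => ?_
  have hsq : (φ n x - f x) ^ 2 ≤ ε ^ 2 / 4 :=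
    le_of_tendsto ((tendsto_const_nhds.sub (hlim x)).pow 2) <|
      eventually_atTop.2 ⟨n, fun k hk => le_of_mul_le_mul_left (hdiff k hk x) (by positivity)⟩
  have hx' : ε ^ 2 ≤ f x ^ 2 := by
    rw [← sq_abs (f x)]
    exact pow_le_pow_left₀ hε.le hx 2
  rw [h0] at hsq
  nlinarith [pow_pos hε 2]
end
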